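/- Let E and F be normed spaces over ℝ with 𝔠 < dim E < dim F, and let m be a positive integer. Then the set NL(^m E; F) is (γ, 2^{dim E})-lineable in L(^m E; F) for every cardinal γ < dim E. -/

import Mathlib

universe w u v

/-- A subset `A` of a real vector space `V` is `β`-lineable if `A ∪ {0}` contains a linear
subspace of `V` of Hamel dimension `β`. -/
def Lineable {V : Type w} [AddCommGroup V] [Module ℝ V] (A : Set V) (β : Cardinal.{w}) : Prop :=
  ∃ S : Submodule ℝ V, Module.rank ℝ ↥S = β ∧ (S : Set V) ⊆ A ∪ {0}

/-- A subset `A` of a real vector space `V` is `(α, β)`-lineable if `A` is `α`-lineable and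
every subspace `W ⊆ A ∪ {0}` with `dim W = α` is contained in a subspace `S` with `dim S = β`
and `W ⊆ S ⊆ A ∪ {0}`. -/
def ABLineable {V : Type w} [AddCommGroup V] [Module ℝ V] (A : Set V)
    (α β : Cardinal.{w}) : Prop :=
  Lineable A α ∧
  ∀ W : Submodule ℝ V, Module.rank ℝ ↥W = α → (W : Set V) ⊆ A ∪ {0} →
    ∃ S : Submodule ℝ V, W ≤ S ∧ Module.rank ℝ ↥S = β ∧ (S : Set V) ⊆ A ∪ {0}

open Cardinal Module

/-- If `P` is a subspace of `V` and `D` is a subspace of infinite dimension `β` disjoint from `P`,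
then the complement of `P` is `(α, β)`-lineable for every `α ≤ β`. -/
theorem ABLineable.of_disjoint {V : Type w} [AddCommGroup V] [Module ℝ V] {P D : Submodule ℝ V}
    (hD : Disjoint P D) {α β : Cardinal.{w}} (hDβ : Module.rank ℝ D = β) (hβ : ℵ₀ ≤ β)
    (hα : α ≤ β) : ABLineable {x : V | x ∉ P} α β := by
  have subset_iff (S : Submodule ℝ V) :
      (S : Set V) ⊆ {x : V | x ∉ P} ∪ {0} ↔ Disjoint P S := by
    rw [Submodule.disjoint_def]
    constructor
    · intro h x hxP hxS
      exact (h hxS).resolve_left fun hx => hx hxP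
    · intro h x hxS
      by_cases hxP : x ∈ P
      · exact Or.inr (h x hxP hxS)
      · exact Or.inl hxP
  refine ⟨?_, fun W hWα hW => ?_⟩
  · rw [← hDβ] at hα
    obtain ⟨s, hs, hli⟩ := le_rank_iff_exists_linearIndependent.1 hα
    refine ⟨(Submodule.span ℝ s).map D.subtype, ?_, ?_⟩
    · rw [rank_map_eq D.injective_subtype, rank_span_set hli, hs]
    · rw [subset_iff]
      exact hD.mono_right (Submodule.map_subtype_le _ _)
  · rw [subset_iff] at hW
    obtain ⟨C, hWC, hC⟩ := hW.symm.exists_isCompl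
    let π := C.projection P hC
    have hπ : Function.Injective (π ∘ₗ D.subtype) := by
      rw [← LinearMap.ker_eq_bot, LinearMap.ker_eq_bot']
      intro x hx
      have hxP : (x : V) ∈ P := (Submodule.projection_apply_eq_zero_iff hC).1 hx
      exact Subtype.ext (Submodule.disjoint_def.1 hD x hxP x.2)
    have hrank : Module.rank ℝ (LinearMap.range (π ∘ₗ D.subtype)) = β := by
      rw [rank_range_of_injective _ hπ, hDβ]
    refine ⟨W ⊔ LinearMap.range (π ∘ₗ D.subtype), le_sup_left, le_antisymm ?_ ?_, ?_⟩
    · refine (Submodule.rank_add_le_rank_add_rank _ _).trans ?_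
      rw [hWα, hrank]
      exact (add_eq_right hβ hα).le
    · rw [← hrank]
      exact Submodule.rank_mono le_sup_right
    · rw [subset_iff]
      refine hC.symm.disjoint.mono_right (sup_le hWC ?_)
      rintro _ ⟨x, rfl⟩
      exact Submodule.projection_apply_mem hC _

/-- The subspace of continuous multilinear maps. -/
def continuousMultilinearSubmodule (E : Type u) (F : Type v) [NormedAddCommGroup E]
    [NormedSpace ℝ E] [NormedAddCommGroup F] [NormedSpace ℝ F] (m : ℕ) :
    Submodule ℝ (MultilinearMap ℝ (fun _ : Fin m => E) F) where
  carrier := {T | Continuous T}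
  add_mem' hS hT := Continuous.add hS hT
  zero_mem' := continuous_const
  smul_mem' c _ hT := Continuous.const_smul hT c

/-- On an infinite-dimensional normed space there is an injective linear family of functionals,
indexed by all functions on a Hamel basis, whose nonzero members are unbounded. -/
theorem exists_linearMap_unbounded {E : Type u} [NormedAddCommGroup E] [NormedSpace ℝ E]
    {ι : Type u} [Infinite ι] (b : Basis ι ℝ E) :
    ∃ Φ : (ι → ℝ) →ₗ[ℝ] E →ₗ[ℝ] ℝ, ∀ f ≠ 0, ∀ C : ℝ, ∃ x, C * ‖x‖ < ‖Φ f x‖ := by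
  have hcard : #ι = #(ι × ℕ) := by simp
  obtain ⟨e⟩ := Cardinal.eq.1 hcard
  let A : (ι → ℝ) →ₗ[ℝ] (ι → ℝ) :=
    { toFun := fun f j => ‖b j‖ * (e j).2 * f (e j).1
      map_add' := fun f g => by ext j; simp [mul_add]
      map_smul' := fun c f => by ext j; simp; ring }
  refine ⟨(b.constr ℝ).toLinearMap ∘ₗ A, fun f hf C => ?_⟩
  obtain ⟨i, hi⟩ := Function.ne_iff.1 hf
  have hi : 0 < |f i| := abs_pos.2 hi
  obtain ⟨n, hn⟩ := exists_nat_gt (C / |f i|)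
  rw [div_lt_iff₀ hi] at hn
  refine ⟨b (e.symm (i, n)), ?_⟩
  have hb : 0 < ‖b (e.symm (i, n))‖ := norm_pos_iff.2 (b.ne_zero _)
  simp only [LinearMap.comp_apply, LinearEquiv.coe_coe, Basis.constr_basis, A, LinearMap.coe_mk,
    AddHom.coe_mk, Equiv.apply_symm_apply, Real.norm_eq_abs, abs_mul, abs_norm, Nat.abs_cast]
  rw [mul_assoc, mul_comm]
  exact mul_lt_mul_of_pos_left hn hb

/-- The multilinear map `(x₀, …, xₖ) ↦ (φ x₀ * ψ x₁ * ⋯ * ψ xₖ) • y`, as a linear function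
of `φ`. -/
def multilinearOfFunctional {E : Type u} {F : Type v} [NormedAddCommGroup E] [NormedSpace ℝ E]
    [NormedAddCommGroup F] [NormedSpace ℝ F] (k : ℕ) (ψ : E →ₗ[ℝ] ℝ) (y : F) :
    (E →ₗ[ℝ] ℝ) →ₗ[ℝ] MultilinearMap ℝ (fun _ : Fin (k + 1) => E) F where
  toFun φ := ((MultilinearMap.mkPiAlgebra ℝ (Fin (k + 1)) ℝ).compLinearMap
    (Fin.cons φ fun _ => ψ)).smulRight y
  map_add' φ φ' := by
    ext x
    simp [Fin.prod_univ_succ, add_mul, add_smul]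
  map_smul' c φ := by
    ext x
    simp [Fin.prod_univ_succ, mul_assoc, mul_smul]

theorem multilinearOfFunctional_apply_cons {E : Type u} {F : Type v} [NormedAddCommGroup E]
    [NormedSpace ℝ E] [NormedAddCommGroup F] [NormedSpace ℝ F] {k : ℕ} {ψ : E →ₗ[ℝ] ℝ} {v : E}
    (hv : ψ v = 1) (y : F) (φ : E →ₗ[ℝ] ℝ) (x : E) :
    multilinearOfFunctional k ψ y φ (Fin.cons x fun _ => v) = φ x • y := by
  simp [multilinearOfFunctional, Fin.prod_univ_succ, hv]

theorem not_continuous_multilinearOfFunctional {E : Type u} {F : Type v} [NormedAddCommGroup E]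
    [NormedSpace ℝ E] [NormedAddCommGroup F] [NormedSpace ℝ F] {k : ℕ} {ψ : E →ₗ[ℝ] ℝ} {v : E}
    (hv : ψ v = 1) {y : F} (hy : y ≠ 0) {φ : E →ₗ[ℝ] ℝ} (hφ : ∀ C : ℝ, ∃ x, C * ‖x‖ < ‖φ x‖) :
    ¬Continuous (multilinearOfFunctional k ψ y φ) := by
  intro hcont
  have hsec : Continuous (φ.smulRight y) := by
    have hcons : Continuous fun x : E => (Fin.cons x fun _ => v : Fin (k + 1) → E) :=
      Continuous.finCons (A := fun _ => E) continuous_id continuous_const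
    convert! hcont.comp hcons using 1
    ext x
    simp [multilinearOfFunctional_apply_cons hv]
  let L : E →L[ℝ] F := ⟨φ.smulRight y, hsec⟩
  obtain ⟨x, hx⟩ := hφ (‖L‖ / ‖y‖)
  have hy : 0 < ‖y‖ := norm_pos_iff.2 hy
  have hLx : ‖φ x‖ * ‖y‖ ≤ ‖L‖ * ‖x‖ := by
    rw [← norm_smul]
    exact L.le_opNorm x
  rw [div_mul_eq_mul_div, div_lt_iff₀ hy] at hx
  exact hLx.not_gt hx

/-- Let `E`, `F` be real normed spaces with `𝔠 < dim E < dim F` and let `m` be a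
positive integer. Then `NL(^m E; F)` is `(γ, 2 ^ dim E)`-lineable in `L(^m E; F)` for every
cardinal `γ < dim E` (with universe lifts to compare cardinals). -/
theorem statement13 (E : Type u) (F : Type v) [NormedAddCommGroup E] [NormedSpace ℝ E]
    [NormedAddCommGroup F] [NormedSpace ℝ F]
    (hE : Cardinal.continuum < Module.rank ℝ E)
    (hEF : Cardinal.lift.{v} (Module.rank ℝ E) < Cardinal.lift.{u} (Module.rank ℝ F))
    (m : ℕ) (hm : 0 < m)
    (γ : Cardinal.{max u v}) (hγ : γ < Cardinal.lift.{v} (Module.rank ℝ E)) :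
    ABLineable
      {T : MultilinearMap ℝ (fun _ : Fin m => E) F | ¬Continuous ⇑T}
      γ (Cardinal.lift.{v} (2 ^ Module.rank ℝ E)) := by
  obtain ⟨k, rfl⟩ := Nat.exists_eq_succ_of_ne_zero hm.ne'
  let b := Basis.ofVectorSpace ℝ E
  have hι : #(Basis.ofVectorSpaceIndex ℝ E) = Module.rank ℝ E := b.mk_eq_rank''
  have hE₀ : ℵ₀ ≤ Module.rank ℝ E := aleph0_le_continuum.trans hE.le
  have : Infinite (Basis.ofVectorSpaceIndex ℝ E) := by
    rwa [Cardinal.infinite_iff, hι]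
  obtain ⟨Φ, hΦ⟩ := exists_linearMap_unbounded b
  obtain ⟨i₀⟩ := (inferInstance : Nonempty (Basis.ofVectorSpaceIndex ℝ E))
  have : Nontrivial F := by
    rw [← rank_pos_iff_nontrivial (R := ℝ), pos_iff_ne_zero]
    intro h
    simp [h] at hEF
  obtain ⟨y, hy⟩ := exists_ne (0 : F)
  let J := multilinearOfFunctional k (b.coord i₀) y ∘ₗ Φ
  have hJ (f) (hf : f ≠ 0) : ¬Continuous (J f) :=
    not_continuous_multilinearOfFunctional (v := b i₀) (by simp) hy (hΦ f hf)
  have hJ_inj : Function.Injective J := by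
    rw [← LinearMap.ker_eq_bot, LinearMap.ker_eq_bot']
    intro f hf
    by_contra hne
    apply hJ f hne
    rw [hf]
    exact continuous_const
  have hdisj : Disjoint (continuousMultilinearSubmodule E F (k + 1)) (LinearMap.range J) := by
    rw [Submodule.disjoint_def]
    rintro _ hT ⟨f, rfl⟩
    by_contra hne
    refine hJ f ?_ hT
    rintro rfl
    exact hne (map_zero J)
  have hrank_fun : Module.rank ℝ (Basis.ofVectorSpaceIndex ℝ E → ℝ) = 2 ^ Module.rank ℝ E := by
    rw [rank_fun_infinite, mk_arrow, mk_real, lift_continuum, lift_uzero, hι]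
    exact power_eq_two_power hE₀ (natCast_le_aleph0.trans aleph0_le_continuum) hE.le
  have hrank : Module.rank ℝ (LinearMap.range J) =
      Cardinal.lift.{v} (2 ^ Module.rank ℝ E) := by
    have h := lift_rank_range_of_injective J hJ_inj
    rw [hrank_fun] at h
    apply Cardinal.lift_injective.{u}
    simpa using h
  refine ABLineable.of_disjoint hdisj hrank ?_ (hγ.le.trans ?_)
  · rw [aleph0_le_lift]
    exact hE₀.trans (cantor _).le
  · rw [lift_le]
    exact (cantor _).le
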